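/- Fix an integer n ≥ 2, x₀ > 0, and fees 0 ≤ ĉ < c < 1. Let λ(·) = (1 - n·(·) + (n-1)·(·)^{n/(n-1)})/n, and let F̃_c and F̃_ĉ be the driftless equilibrium cdfs: F̃_c(x) = (c + λ(c)·x/x₀)^{1/(n-1)} on [0, (1-c)x₀/λ(c)], equal to 1 above, and similarly for ĉ. Then F̃_ĉ second-order stochastically dominates F̃_c: for every t ≥ 0, ∫₀^t F̃_ĉ(x) dx ≤ ∫₀^t F̃_c(x) dx. -/

import Mathlib

/-- The slope coefficient `λ(c) = (1 - n·c + (n-1)·c^{n/(n-1)})/n` of the equilibrium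
winning probability in the `n`-player risk-taking contest with submission fee `c`. -/
noncomputable def lamFee (n : ℕ) (c : ℝ) : ℝ :=
  (1 - n * c + ((n : ℝ) - 1) * c ^ ((n : ℝ) / ((n : ℝ) - 1))) / n

/-- Upper bound of the support of the driftless equilibrium distribution:
`x̄(c) = (1-c)·x₀/λ(c)`. -/
noncomputable def tildeXbar (n : ℕ) (x₀ c : ℝ) : ℝ :=
  (1 - c) * x₀ / lamFee n c

/-- The driftless equilibrium cdf: `F̃_c(x) = (c + λ(c)·x/x₀)^{1/(n-1)}` on `[0, x̄(c)]`,
equal to `1` above `x̄(c)` and `0` below `0`. -/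
noncomputable def tildeF (n : ℕ) (x₀ c x : ℝ) : ℝ :=
  if x < 0 then 0
  else if x ≤ tildeXbar n x₀ c then (c + lamFee n c * x / x₀) ^ ((1 : ℝ) / ((n : ℝ) - 1))
  else 1

open Set intervalIntegral

lemma lamFee_one (n : ℕ) : lamFee n 1 = 0 := by
  simp [lamFee]

lemma lamFee_strictAntiOn {n : ℕ} (hn : 2 ≤ n) : StrictAntiOn (lamFee n) (Icc 0 1) := by
  have hn2 : (2 : ℝ) ≤ n := by exact_mod_cast hn
  have hn1 : (0 : ℝ) < n - 1 := by linarith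
  have hq : (1 : ℝ) < (n : ℝ) / ((n : ℝ) - 1) := by
    rw [lt_div_iff₀ hn1]; linarith
  have hderiv (x : ℝ) : HasDerivAt (lamFee n) (x ^ ((n : ℝ) / ((n : ℝ) - 1) - 1) - 1) x := by
    have h := ((((hasDerivAt_id x).const_mul (n : ℝ)).const_sub 1).add
      ((Real.hasDerivAt_rpow_const (x := x) (Or.inr hq.le)).const_mul ((n : ℝ) - 1))).div_const
        (n : ℝ)
    refine h.congr_deriv ?_
    field_simp
    ring
  refine strictAntiOn_of_deriv_neg (convex_Icc 0 1)
    (fun x _ => (hderiv x).continuousAt.continuousWithinAt) fun x hx => ?_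
  rw [interior_Icc] at hx
  rw [(hderiv x).deriv, sub_neg]
  exact Real.rpow_lt_one hx.1.le hx.2 (by linarith)

lemma lamFee_pos {n : ℕ} (hn : 2 ≤ n) {c : ℝ} (hc₀ : 0 ≤ c) (hc : c < 1) : 0 < lamFee n c := by
  rw [← lamFee_one n]
  exact lamFee_strictAntiOn hn ⟨hc₀, hc.le⟩ ⟨zero_le_one, le_rfl⟩ hc

lemma lamFee_mul_tildeXbar_div {n : ℕ} {x₀ c : ℝ} (hx₀ : x₀ ≠ 0) (hl : lamFee n c ≠ 0) :
    lamFee n c * tildeXbar n x₀ c / x₀ = 1 - c := by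
  unfold tildeXbar
  field_simp

lemma tildeXbar_nonneg {n : ℕ} (hn : 2 ≤ n) {x₀ : ℝ} (hx₀ : 0 < x₀) {c : ℝ} (hc₀ : 0 ≤ c)
    (hc : c < 1) : 0 ≤ tildeXbar n x₀ c :=
  div_nonneg (mul_nonneg (by linarith) hx₀.le) (lamFee_pos hn hc₀ hc).le

lemma tildeF_eq_min {n : ℕ} (hn : 2 ≤ n) {x₀ : ℝ} (hx₀ : 0 < x₀) {c : ℝ} (hc₀ : 0 ≤ c)
    (hc : c < 1) {x : ℝ} (hx : 0 ≤ x) :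
    tildeF n x₀ c x = (min 1 (c + lamFee n c * x / x₀)) ^ ((1 : ℝ) / ((n : ℝ) - 1)) := by
  have hl := lamFee_pos hn hc₀ hc
  have hX := lamFee_mul_tildeXbar_div hx₀.ne' hl.ne'
  rw [tildeF, if_neg hx.not_gt]
  split_ifs with h
  · have : lamFee n c * x / x₀ ≤ lamFee n c * tildeXbar n x₀ c / x₀ := by gcongr
    rw [min_eq_right (by linarith)]
  · have : lamFee n c * tildeXbar n x₀ c / x₀ ≤ lamFee n c * x / x₀ := by
      have := (not_le.1 h).le
      gcongr
    rw [min_eq_left (by linarith), Real.one_rpow]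

lemma intervalIntegrable_tildeF {n : ℕ} (hn : 2 ≤ n) {x₀ : ℝ} (hx₀ : 0 < x₀) {c : ℝ}
    (hc₀ : 0 ≤ c) (hc : c < 1) {a b : ℝ} (ha : 0 ≤ a) (hb : 0 ≤ b) :
    IntervalIntegrable (tildeF n x₀ c) MeasureTheory.volume a b := by
  have hn2 : (2 : ℝ) ≤ n := by exact_mod_cast hn
  have hp : 0 ≤ (1 : ℝ) / ((n : ℝ) - 1) := one_div_nonneg.2 (by linarith)
  have hcont : Continuous fun x : ℝ =>
      (min 1 (c + lamFee n c * x / x₀)) ^ ((1 : ℝ) / ((n : ℝ) - 1)) :=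
    Continuous.rpow_const (by fun_prop) fun _ => Or.inr hp
  refine (hcont.intervalIntegrable a b).congr fun x hx => ?_
  exact (tildeF_eq_min hn hx₀ hc₀ hc ((le_min ha hb).trans hx.1.le)).symm

/-- Beyond the support, the integral of the cdf reflects its mean `x₀`. -/
lemma integral_tildeF_of_tildeXbar_le {n : ℕ} (hn : 2 ≤ n) {x₀ : ℝ} (hx₀ : 0 < x₀) {c : ℝ}
    (hc₀ : 0 ≤ c) (hc : c < 1) {T : ℝ} (hT : tildeXbar n x₀ c ≤ T) :
    ∫ x in (0 : ℝ)..T, tildeF n x₀ c x = T - x₀ := by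
  have hn2 : (2 : ℝ) ≤ n := by exact_mod_cast hn
  have hn1 : (0 : ℝ) < n - 1 := by linarith
  have hp : 0 ≤ (1 : ℝ) / ((n : ℝ) - 1) := one_div_nonneg.2 hn1.le
  have hl := lamFee_pos hn hc₀ hc
  have hX := lamFee_mul_tildeXbar_div hx₀.ne' hl.ne'
  have hX₀ := tildeXbar_nonneg hn hx₀ hc₀ hc
  rw [← integral_add_adjacent_intervals
    (intervalIntegrable_tildeF hn hx₀ hc₀ hc le_rfl hX₀)
    (intervalIntegrable_tildeF hn hx₀ hc₀ hc hX₀ (hX₀.trans hT))]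
  have hlow : ∫ x in (0 : ℝ)..tildeXbar n x₀ c, tildeF n x₀ c x =
      ∫ x in (0 : ℝ)..tildeXbar n x₀ c,
        (c + lamFee n c / x₀ * x) ^ ((1 : ℝ) / ((n : ℝ) - 1)) := by
    refine integral_congr fun x hx => ?_
    rw [uIcc_of_le hX₀] at hx
    simp only [tildeF, if_neg hx.1.not_gt, if_pos hx.2]
    rw [div_mul_eq_mul_div]
  have hhigh : ∫ x in tildeXbar n x₀ c..T, tildeF n x₀ c x =
      ∫ _ in tildeXbar n x₀ c..T, (1 : ℝ) := by
    refine integral_congr_ae (Filter.Eventually.of_forall fun x hx => ?_)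
    rw [uIoc_of_le hT] at hx
    rw [tildeF, if_neg (hX₀.trans hx.1.le).not_gt, if_neg hx.1.not_ge]
  have hend : c + lamFee n c / x₀ * tildeXbar n x₀ c = 1 := by
    rw [div_mul_eq_mul_div, hX]; ring
  have hexp : (1 : ℝ) / ((n : ℝ) - 1) + 1 = (n : ℝ) / ((n : ℝ) - 1) := by
    field_simp; ring
  rw [hlow, hhigh, integral_const,
    integral_comp_add_mul (fun u : ℝ => u ^ ((1 : ℝ) / ((n : ℝ) - 1))) (div_pos hl hx₀).ne' c,
    integral_rpow (Or.inl (by linarith)), hend, hexp, Real.one_rpow, mul_zero, add_zero]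
  have hdef : lamFee n c * n =
      1 - n * c + ((n : ℝ) - 1) * c ^ ((n : ℝ) / ((n : ℝ) - 1)) :=
    div_mul_cancel₀ _ (by positivity)
  have hXdef : tildeXbar n x₀ c = (1 - c) * x₀ / lamFee n c := rfl
  rw [hXdef]
  generalize c ^ ((n : ℝ) / ((n : ℝ) - 1)) = w at *
  generalize lamFee n c = l at *
  simp only [smul_eq_mul]
  field_simp
  linear_combination x₀ * hdef

lemma tildeF_le_tildeF {n : ℕ} (hn : 2 ≤ n) {x₀ : ℝ} (hx₀ : 0 < x₀) {a b : ℝ} (ha₀ : 0 ≤ a)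
    (ha : a < 1) (hb₀ : 0 ≤ b) (hb : b < 1) {x : ℝ} (hx : 0 ≤ x)
    (h : a + lamFee n a * x / x₀ ≤ b + lamFee n b * x / x₀) :
    tildeF n x₀ a x ≤ tildeF n x₀ b x := by
  have hn2 : (2 : ℝ) ≤ n := by exact_mod_cast hn
  have hl := lamFee_pos hn ha₀ ha
  rw [tildeF_eq_min hn hx₀ ha₀ ha hx, tildeF_eq_min hn hx₀ hb₀ hb hx]
  exact Real.rpow_le_rpow (le_min zero_le_one (by positivity)) (min_le_min_left 1 h)
    (one_div_nonneg.2 (by linarith))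

/-- The driftless equilibrium distribution for a lower fee second-order stochastically
dominates that for a higher fee: the lower-fee cdf has pointwise smaller integrals. -/
theorem tildeF_ssd (n : ℕ) (hn : 2 ≤ n) (x₀ : ℝ) (hx₀ : 0 < x₀)
    (c c' : ℝ) (hc' : 0 ≤ c') (hc'c : c' < c) (hc : c < 1) :
    ∀ t : ℝ, 0 ≤ t →
      (∫ x in (0 : ℝ)..t, tildeF n x₀ c' x) ≤ ∫ x in (0 : ℝ)..t, tildeF n x₀ c x := by
  intro t ht
  have hc₀ : 0 ≤ c := hc'.trans hc'c.le
  have hc'1 : c' < 1 := hc'c.trans hc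
  have hl : lamFee n c < lamFee n c' :=
    lamFee_strictAntiOn hn ⟨hc', hc'1.le⟩ ⟨hc₀, hc.le⟩ hc'c
  have hgap {x y : ℝ} (hxy : x ≤ y) :
      lamFee n c' * x / x₀ - lamFee n c * x / x₀ ≤
        lamFee n c' * y / x₀ - lamFee n c * y / x₀ := by
    rw [← sub_div, ← sub_div, ← sub_mul, ← sub_mul]
    have := sub_nonneg.2 hl.le
    gcongr
  rcases le_total (c' + lamFee n c' * t / x₀) (c + lamFee n c * t / x₀) with h | h
  · refine integral_mono_on ht (intervalIntegrable_tildeF hn hx₀ hc' hc'1 le_rfl ht)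
      (intervalIntegrable_tildeF hn hx₀ hc₀ hc le_rfl ht) fun x hx => ?_
    refine tildeF_le_tildeF hn hx₀ hc' hc'1 hc₀ hc hx.1 ?_
    linarith [hgap hx.2]
  · obtain ⟨T, hT⟩ : ∃ T, T = max t (max (tildeXbar n x₀ c) (tildeXbar n x₀ c')) := ⟨_, rfl⟩
    have htT : t ≤ T := hT ▸ le_max_left _ _
    have hT₀ := ht.trans htT
    have htail : ∫ x in t..T, tildeF n x₀ c x ≤ ∫ x in t..T, tildeF n x₀ c' x := by
      refine integral_mono_on htT (intervalIntegrable_tildeF hn hx₀ hc₀ hc ht hT₀)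
        (intervalIntegrable_tildeF hn hx₀ hc' hc'1 ht hT₀) fun x hx => ?_
      refine tildeF_le_tildeF hn hx₀ hc₀ hc hc' hc'1 (ht.trans hx.1) ?_
      linarith [hgap hx.1]
    have hI := integral_add_adjacent_intervals
      (intervalIntegrable_tildeF hn hx₀ hc₀ hc le_rfl ht)
      (intervalIntegrable_tildeF hn hx₀ hc₀ hc ht hT₀)
    have hI' := integral_add_adjacent_intervals
      (intervalIntegrable_tildeF hn hx₀ hc' hc'1 le_rfl ht)
      (intervalIntegrable_tildeF hn hx₀ hc' hc'1 ht hT₀)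
    rw [integral_tildeF_of_tildeXbar_le (T := T) hn hx₀ hc₀ hc
      (hT ▸ (le_max_left _ _).trans (le_max_right _ _))] at hI
    rw [integral_tildeF_of_tildeXbar_le (T := T) hn hx₀ hc' hc'1
      (hT ▸ (le_max_right _ _).trans (le_max_right _ _))] at hI'
    linarith
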